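/- Gauge transformation of the hypergeometric operator: for all complex α, β, μ and z with z(1-z) ≠ 0, one has -z^{(α-1)/2}(1-z)^{(β-1)/2} ∘ F((α+β+μ+1)/2, (α+β-μ+1)/2; 1+α; z, ∂_z) ∘ z^{-(α+1)/2}(1-z)^{-(β+1)/2} = -∂_z² + (α²-1)/(4z²(1-z)) + (β²-1)/(4z(1-z)²) - (μ²-1)/(4z(1-z)), as an identity of differential operators applied to any twice-differentiable function. -/

import Mathlib

theorem gauge_weight_hasDerivAt (s t : ℂ) (x : ℝ) (hx : x ∈ Set.Ioo (0:ℝ) 1) :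
    HasDerivAt (fun x : ℝ => (x : ℂ) ^ s * ((1 : ℂ) - x) ^ t)
      ((x : ℂ) ^ s * ((1 : ℂ) - x) ^ t * (s / x - t / (1 - x))) x := by
  have h0 : (x : ℂ) ≠ 0 := by exact_mod_cast hx.1.ne'
  have h1 : (1 : ℂ) - x ≠ 0 := by
    have : (1 : ℝ) - x ≠ 0 := (sub_pos.2 hx.2).ne'
    exact_mod_cast this
  have s0 : (x : ℂ) ∈ Complex.slitPlane := Complex.ofReal_mem_slitPlane.2 hx.1
  have s1 : (1 : ℂ) - x ∈ Complex.slitPlane := by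
    have := Complex.ofReal_mem_slitPlane.2 (sub_pos.2 hx.2)
    simpa using this
  have d0 : HasDerivAt (fun y : ℂ => y ^ s) _ (x : ℂ) :=
    (hasDerivAt_id (x : ℂ)).cpow_const s0
  have d1 : HasDerivAt (fun y : ℂ => ((1 : ℂ) - y) ^ t) _ (x : ℂ) :=
    ((hasDerivAt_id (x : ℂ)).const_sub 1).cpow_const s1
  refine ((d0.mul d1).comp_ofReal).congr_deriv ?_
  simp only [id]
  rw [Complex.cpow_sub _ _ h0, Complex.cpow_sub _ _ h1, Complex.cpow_one, Complex.cpow_one]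
  field_simp
  ring

/-- Gauge transformation of the hypergeometric operator
`F(a,b;c;z,∂_z) = z(1-z)∂² + (c-(a+b+1)z)∂ - ab` with
`a = (α+β+μ+1)/2`, `b = (α+β-μ+1)/2`, `c = 1+α`:
`-z^{(α-1)/2}(1-z)^{(β-1)/2} ∘ F ∘ z^{-(α+1)/2}(1-z)^{-(β+1)/2}`
`= -∂² + (α²-1)/(4z²(1-z)) + (β²-1)/(4z(1-z)²) - (μ²-1)/(4z(1-z))`,
for the real variable `0 < z < 1`. -/
theorem hypergeometric_gauge_transform
    (α β μ : ℂ) (f : ℝ → ℂ)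
    (hf1 : Differentiable ℝ f) (hf2 : Differentiable ℝ (deriv f))
    (a b c : ℂ)
    (ha : a = (α + β + μ + 1) / 2) (hb : b = (α + β - μ + 1) / 2)
    (hc : c = 1 + α)
    (g : ℝ → ℂ)
    (hg : g = fun x : ℝ =>
      (x : ℂ) ^ (-(α + 1) / 2) * ((1 : ℂ) - x) ^ (-(β + 1) / 2) * f x) :
    ∀ z ∈ Set.Ioo (0:ℝ) 1,
      -((z : ℂ) ^ ((α - 1) / 2) * ((1 : ℂ) - z) ^ ((β - 1) / 2))
          * ((z : ℂ) * (1 - (z : ℂ)) * deriv (deriv g) z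
              + (c - (a + b + 1) * (z : ℂ)) * deriv g z
              - a * b * g z)
        = -(deriv (deriv f) z)
          + ((α ^ 2 - 1) / (4 * (z : ℂ) ^ 2 * (1 - (z : ℂ)))
              + (β ^ 2 - 1) / (4 * (z : ℂ) * (1 - (z : ℂ)) ^ 2)
              - (μ ^ 2 - 1) / (4 * (z : ℂ) * (1 - (z : ℂ)))) * f z := by
  intro z hz
  have h0 : (z : ℂ) ≠ 0 := by exact_mod_cast hz.1.ne'
  have h1 : (1 : ℂ) - z ≠ 0 := by
    have : (1 : ℝ) - z ≠ 0 := (sub_pos.2 hz.2).ne'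
    exact_mod_cast this
  set s : ℂ := -(α + 1) / 2 with hs
  set t : ℂ := -(β + 1) / 2 with ht
  have D1 : ∀ x ∈ Set.Ioo (0:ℝ) 1, deriv g x =
      (x : ℂ) ^ s * ((1 : ℂ) - x) ^ t * ((s / x - t / (1 - x)) * f x + deriv f x) := by
    intro x hx
    rw [hg]
    refine (((gauge_weight_hasDerivAt s t x hx).mul (hf1 x).hasDerivAt).congr_deriv ?_).deriv
    ring
  have dq : HasDerivAt (fun x : ℝ => s / (x : ℂ) - t / (1 - (x : ℂ)))
      (-s / (z : ℂ) ^ 2 - t / (1 - (z : ℂ)) ^ 2) z := by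
    have e0 : HasDerivAt (fun y : ℂ => s / y) _ (z : ℂ) :=
      (hasDerivAt_const (z : ℂ) s).div (hasDerivAt_id (z : ℂ)) h0
    have e1 : HasDerivAt (fun y : ℂ => t / (1 - y)) _ (z : ℂ) :=
      (hasDerivAt_const (z : ℂ) t).div ((hasDerivAt_id (z : ℂ)).const_sub 1) h1
    refine ((e0.sub e1).comp_ofReal).congr_deriv ?_
    simp
  have D2 : deriv (deriv g) z = (z : ℂ) ^ s * ((1 : ℂ) - z) ^ t *
      ((s / z - t / (1 - z)) * ((s / z - t / (1 - z)) * f z + deriv f z) +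
        ((-s / (z : ℂ) ^ 2 - t / (1 - (z : ℂ)) ^ 2) * f z
          + (s / z - t / (1 - z)) * deriv f z + deriv (deriv f) z)) := by
    have ev : deriv g =ᶠ[nhds z] fun x : ℝ =>
        (x : ℂ) ^ s * ((1 : ℂ) - x) ^ t * ((s / x - t / (1 - x)) * f x + deriv f x) := by
      filter_upwards [isOpen_Ioo.mem_nhds hz] with x hx using D1 x hx
    rw [ev.deriv_eq]
    refine (((gauge_weight_hasDerivAt s t z hz).mul
      ((dq.mul (hf1 z).hasDerivAt).add (hf2 z).hasDerivAt)).congr_deriv ?_).deriv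
    simp only [Pi.add_apply, Pi.mul_apply]
    ring
  have P0 : (z : ℂ) ^ ((α - 1) / 2) * (z : ℂ) ^ s = (z : ℂ)⁻¹ := by
    rw [← Complex.cpow_add _ _ h0, ← Complex.cpow_neg_one]
    congr 1
    rw [hs]; ring
  have P1 : ((1 : ℂ) - z) ^ ((β - 1) / 2) * ((1 : ℂ) - z) ^ t = ((1 : ℂ) - z)⁻¹ := by
    rw [← Complex.cpow_add _ _ h1, ← Complex.cpow_neg_one]
    congr 1
    rw [ht]; ring
  have G : g z = (z : ℂ) ^ s * ((1 : ℂ) - z) ^ t * f z := by rw [hg]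
  rw [D2, D1 z hz, G]
  generalize deriv (deriv f) z = f2
  generalize deriv f z = f1
  generalize f z = f0
  have key : ∀ A B C E X Y Z p q r : ℂ, -(A * B) * (p * (C * E * X) + q * (C * E * Y)
      - r * (C * E * Z)) = -((A * C) * (B * E)) * (p * X + q * Y - r * Z) := by
    intros; ring
  rw [key, P0, P1, ha, hb, hc, hs, ht]
  field_simp
  ring
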